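/- Define g(x) = x(2 + sin log x) for x ≥ 1, with inverse g^{-1}: [2,∞) → [1,∞). Let X_P be a standard Pareto random variable, B an independent random variable uniform on {0,1}, Y = B·X_P + (1-B)·(-g^{-1}(2·X_P)), and let X_L and Y_L be the Laplace-scale transforms of X_P and Y. Then for every real z, lim_{t→∞} P(Y_L - X_L ≤ z | X_L > t) = (1/2)(1 + 1{z ≥ log 2}), i.e. the limit equals 1/2 for z < log 2 and 1 for z ≥ log 2; in particular the limit distribution is non-degenerate with mass 1/2 at -∞ and mass 1/2 at the point log 2. -/

import Mathlib

open MeasureTheory ProbabilityTheory Filter Set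

/-- Inverse CDF of the standard Laplace distribution. -/
noncomputable def lapInv (p : ℝ) : ℝ :=
  if p ≤ 1/2 then Real.log (2 * p) else -Real.log (2 * (1 - p))

theorem strictMonoOn_mul_two_add_sin_log :
    StrictMonoOn (fun x : ℝ => x * (2 + Real.sin (Real.log x))) (Ioi 0) := by
  have hder : ∀ x ∈ Ioi (0 : ℝ), HasDerivAt (fun x : ℝ => x * (2 + Real.sin (Real.log x)))
      (2 + Real.sin (Real.log x) + Real.cos (Real.log x)) x := by
    intro x hx
    have hx0 : x ≠ 0 := ne_of_gt hx
    refine ((hasDerivAt_id' x).mul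
      (((Real.hasDerivAt_log hx0).sin).const_add 2)).congr_deriv ?_
    field_simp
  refine strictMonoOn_of_deriv_pos (convex_Ioi 0)
    (fun x hx => (hder x hx).continuousAt.continuousWithinAt) fun x hx => ?_
  rw [interior_Ioi] at hx
  rw [(hder x hx).deriv]
  nlinarith [Real.sin_sq_add_cos_sq (Real.log x),
    sq_nonneg (Real.sin (Real.log x) - Real.cos (Real.log x))]

theorem lapInv_of_half_le {p : ℝ} (hp : 1 / 2 ≤ p) : lapInv p = -Real.log (2 * (1 - p)) := by
  unfold lapInv
  split_ifs with h
  · obtain rfl : p = 1 / 2 := le_antisymm h hp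
    norm_num
  · rfl

theorem lapInv_of_le_half {p : ℝ} (hp : p ≤ 1 / 2) : lapInv p = Real.log (2 * p) := if_pos hp

section Pareto

variable {Ω : Type*} [MeasurableSpace Ω] {μ : Measure Ω} {X B : Ω → ℝ}

theorem pareto_real_le
    (hX : ∀ x : ℝ, μ {ω | X ω ≤ x} = if x < 1 then 0 else ENNReal.ofReal (1 - 1 / x))
    {a : ℝ} (ha : 1 ≤ a) : μ.real {ω | X ω ≤ a} = 1 - 1 / a := by
  have h : 1 / a ≤ 1 := by rw [div_le_one (by linarith)]; exact ha
  rw [measureReal_def, hX, if_neg (not_lt.2 ha), ENNReal.toReal_ofReal (by linarith)]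

theorem pareto_real_lt [IsProbabilityMeasure μ] (hXm : Measurable X)
    (hX : ∀ x : ℝ, μ {ω | X ω ≤ x} = if x < 1 then 0 else ENNReal.ofReal (1 - 1 / x))
    {a : ℝ} (ha : 1 ≤ a) : μ.real {ω | a < X ω} = 1 / a := by
  have h := probReal_compl_eq_one_sub (μ := μ) (measurableSet_le hXm (measurable_const (a := a)))
  rw [pareto_real_le hX ha] at h
  have e : {ω | X ω ≤ a}ᶜ = {ω | a < X ω} := by ext; simp
  rw [← e, h]; ring

theorem pareto_ae_one_lt
    (hX : ∀ x : ℝ, μ {ω | X ω ≤ x} = if x < 1 then 0 else ENNReal.ofReal (1 - 1 / x)) :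
    ∀ᵐ ω ∂μ, 1 < X ω := by
  rw [ae_iff]
  simp only [not_lt]
  rw [hX]; simp

theorem pareto_real_ge [IsProbabilityMeasure μ] (hXm : Measurable X)
    (hX : ∀ x : ℝ, μ {ω | X ω ≤ x} = if x < 1 then 0 else ENNReal.ofReal (1 - 1 / x))
    {a : ℝ} (ha : 1 < a) : μ.real {ω | a ≤ X ω} = 1 / a := by
  apply le_antisymm
  · have hc : Tendsto (fun b : ℝ => 1 / b) (nhdsWithin a (Iio a)) (nhds (1 / a)) :=
      (ContinuousAt.div continuousAt_const continuousAt_id (by simp; linarith)).tendsto.mono_left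
        nhdsWithin_le_nhds
    refine ge_of_tendsto hc ?_
    filter_upwards [Ioo_mem_nhdsLT ha] with b hb
    rw [← pareto_real_lt hXm hX hb.1.le]
    exact measureReal_mono fun ω hω => lt_of_lt_of_le hb.2 hω
  · rw [← pareto_real_lt hXm hX ha.le]
    exact measureReal_mono fun ω (hω : a < X ω) => hω.le

theorem measureReal_inter_of_indepFun (hindep : IndepFun B X μ) (c : ℝ) {s : Set ℝ}
    (hs : MeasurableSet s) :
    μ.real ({ω | B ω = c} ∩ {ω | X ω ∈ s}) = μ.real {ω | B ω = c} * μ.real {ω | X ω ∈ s} := by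
  have h := hindep.measure_inter_preimage_eq_mul {c} s (measurableSet_singleton c) hs
  simp only [measureReal_def, ← ENNReal.toReal_mul]
  exact congrArg ENNReal.toReal h

end Pareto

theorem stmt13 {Ω : Type*} [MeasurableSpace Ω] (μ : Measure Ω) [IsProbabilityMeasure μ]
    (X B : Ω → ℝ) (hXm : Measurable X) (hBm : Measurable B)
    (hX : ∀ x : ℝ, μ {ω | X ω ≤ x} = if x < 1 then 0 else ENNReal.ofReal (1 - 1 / x))
    (hBvals : ∀ ω, B ω = 0 ∨ B ω = 1)
    (hB0 : μ {ω | B ω = 0} = 1/2) (hB1 : μ {ω | B ω = 1} = 1/2)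
    (hindep : IndepFun B X μ)
    (g : ℝ → ℝ) (hg : ∀ x : ℝ, g x = x * (2 + Real.sin (Real.log x)))
    (ginv : ℝ → ℝ)
    (hginv1 : ∀ x : ℝ, 1 ≤ x → ginv (g x) = x)
    (hginv2 : ∀ y : ℝ, 2 ≤ y → 1 ≤ ginv y ∧ g (ginv y) = y)
    (Y : Ω → ℝ) (hY : ∀ ω, Y ω = B ω * X ω + (1 - B ω) * (-(ginv (2 * X ω))))
    (XL YL : Ω → ℝ)
    (hXL : ∀ ω, XL ω = lapInv (1 - 1 / X ω))
    (hYL : ∀ ω, YL ω = lapInv ((μ {ω' | Y ω' ≤ Y ω}).toReal)) :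
    ∀ z : ℝ,
      Tendsto (fun t : ℝ =>
          (μ ({ω | YL ω - XL ω ≤ z} ∩ {ω | t < XL ω})).toReal / (μ {ω | t < XL ω}).toReal)
        atTop (nhds (if Real.log 2 ≤ z then 1 else 1/2)) := by
  intro z
  have hl2 : 0 < Real.log 2 := Real.log_pos one_lt_two
  have hae := pareto_ae_one_lt hX
  have hB0r : μ.real {ω | B ω = 0} = 1 / 2 := by simp [measureReal_def, hB0]
  have hB1r : μ.real {ω | B ω = 1} = 1 / 2 := by simp [measureReal_def, hB1]
  have hginv_le : ∀ a b : ℝ, 2 ≤ a → 2 ≤ b → (ginv a ≤ ginv b ↔ a ≤ b) := by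
    intro a b ha hb
    obtain ⟨ha1, ha2⟩ := hginv2 a ha
    obtain ⟨hb1, hb2⟩ := hginv2 b hb
    have h := strictMonoOn_mul_two_add_sin_log.le_iff_le (a := ginv a) (b := ginv b)
      (zero_lt_one.trans_le ha1) (zero_lt_one.trans_le hb1)
    simp only [← hg, ha2, hb2] at h
    exact h.symm
  have hY1 : ∀ ω, B ω = 1 → Y ω = X ω := fun ω h => by rw [hY, h]; ring
  have hY0 : ∀ ω, B ω = 0 → Y ω = -ginv (2 * X ω) := fun ω h => by rw [hY, h]; ring
  have hYL1 : ∀ ω, 1 < X ω → B ω = 1 → YL ω = Real.log (X ω) := by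
    intro ω hω hB
    have hcdf : μ.real {ω' | Y ω' ≤ Y ω} = 1 - 1 / (2 * X ω) := by
      have hset : {ω' | Y ω' ≤ Y ω} =ᵐ[μ]
          ({ω' | B ω' = 0} ∪ ({ω' | B ω' = 1} ∩ {ω' | X ω' ∈ Iic (X ω)}) : Set Ω) := by
        filter_upwards [hae] with ω' hω'
        apply propext
        change Y ω' ≤ Y ω ↔ B ω' = 0 ∨ (B ω' = 1 ∧ X ω' ≤ X ω)
        rw [hY1 ω hB]
        rcases hBvals ω' with h | h
        · have := (hginv2 (2 * X ω') (by linarith)).1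
          simp only [h, true_or, iff_true, hY0 ω' h]
          linarith
        · simp [h, hY1 ω' h]
      have hdisj : Disjoint {ω' | B ω' = 0} ({ω' | B ω' = 1} ∩ {ω' | X ω' ∈ Iic (X ω)}) := by
        rw [Set.disjoint_left]
        rintro ω' h0 ⟨h1, -⟩
        simp only [mem_ofPred_eq] at h0 h1
        linarith
      rw [measureReal_congr hset, measureReal_union hdisj
        ((hBm (measurableSet_singleton 1)).inter (hXm measurableSet_Iic)),
        measureReal_inter_of_indepFun hindep 1 measurableSet_Iic, hB0r, hB1r]
      simp only [mem_Iic]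
      rw [pareto_real_le hX hω.le]
      field_simp
      ring
    have h2 : 1 / (2 * X ω) ≤ 1 / 2 := one_div_le_one_div_of_le two_pos (by linarith)
    rw [hYL, ← measureReal_def, hcdf, lapInv_of_half_le (by linarith), ← Real.log_inv]
    congr 1
    field_simp
    ring
  have hYL0 : ∀ ω, 1 < X ω → B ω = 0 → YL ω = -Real.log (X ω) := by
    intro ω hω hB
    have hcdf : μ.real {ω' | Y ω' ≤ Y ω} = 1 / (2 * X ω) := by
      have hset : {ω' | Y ω' ≤ Y ω} =ᵐ[μ]
          ({ω' | B ω' = 0} ∩ {ω' | X ω' ∈ Ici (X ω)} : Set Ω) := by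
        filter_upwards [hae] with ω' hω'
        apply propext
        change Y ω' ≤ Y ω ↔ B ω' = 0 ∧ X ω ≤ X ω'
        rw [hY0 ω hB]
        rcases hBvals ω' with h | h
        · rw [hY0 ω' h, neg_le_neg_iff, hginv_le _ _ (by linarith) (by linarith)]
          simp [h]
        · have := (hginv2 (2 * X ω) (by linarith)).1
          simp only [h, one_ne_zero, false_and, iff_false, hY1 ω' h]
          linarith
      rw [measureReal_congr hset, measureReal_inter_of_indepFun hindep 0 measurableSet_Ici, hB0r]
      simp only [mem_Ici]
      rw [pareto_real_ge hXm hX hω]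
      field_simp
    have h2 : 1 / (2 * X ω) ≤ 1 / 2 := one_div_le_one_div_of_le two_pos (by linarith)
    rw [hYL, ← measureReal_def, hcdf, lapInv_of_le_half h2, ← Real.log_inv]
    congr 1
    field_simp
  have hXL2 : ∀ ω, 2 ≤ X ω → XL ω = Real.log (X ω) - Real.log 2 := by
    intro ω hω
    have h2 : 1 / X ω ≤ 1 / 2 := one_div_le_one_div_of_le two_pos hω
    rw [hXL, lapInv_of_half_le (by linarith), ← Real.log_div (by linarith) two_ne_zero,
      ← Real.log_inv]
    congr 1
    have : X ω ≠ 0 := by linarith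
    field_simp
    ring
  have hXLlt : ∀ ω, 1 < X ω → X ω < 2 → XL ω ≤ 0 := by
    intro ω h1 h2
    have hlo : 1 / 2 ≤ 1 / X ω := one_div_le_one_div_of_le (by linarith) h2.le
    have hhi : 1 / X ω ≤ 1 := by rw [div_le_one (by linarith)]; exact h1.le
    rw [hXL, lapInv_of_le_half (by linarith)]
    exact Real.log_nonpos (by linarith) (by linarith)
  have hXLgt : ∀ t, 0 ≤ t → ∀ ω, 1 < X ω → (t < XL ω ↔ 2 * Real.exp t < X ω) := by
    intro t ht ω h1
    have hexp : 1 ≤ Real.exp t := Real.one_le_exp ht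
    rcases lt_or_ge (X ω) 2 with h | h
    · have := hXLlt ω h1 h
      exact iff_of_false (by linarith) (by linarith)
    · rw [hXL2 ω h, ← Real.log_div (by linarith) two_ne_zero, Real.lt_log_iff_exp_lt (by linarith),
        lt_div_iff₀ two_pos, mul_comm]
  refine tendsto_const_nhds.congr' ?_
  filter_upwards [eventually_ge_atTop (0 : ℝ), eventually_ge_atTop (-z)] with t ht htz
  have hexp : 1 ≤ Real.exp t := Real.one_le_exp ht
  have hden : {ω | t < XL ω} =ᵐ[μ] {ω | X ω ∈ Ioi (2 * Real.exp t)} := by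
    filter_upwards [hae] with ω h1
    exact propext (hXLgt t ht ω h1)
  have hdiff0 : ∀ ω, 1 < X ω → t < XL ω → B ω = 0 → YL ω - XL ω ≤ z := by
    intro ω h1 h hB
    have h3 := (hXLgt t ht ω h1).1 h
    rw [hXL2 ω (by linarith)] at h ⊢
    rw [hYL0 ω h1 hB]
    linarith
  have hdiff1 : ∀ ω, 1 < X ω → t < XL ω → B ω = 1 → YL ω - XL ω = Real.log 2 := by
    intro ω h1 h hB
    have h3 := (hXLgt t ht ω h1).1 h
    rw [hXL2 ω (by linarith), hYL1 ω h1 hB]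
    ring
  have hdenval : μ.real {ω | X ω ∈ Ioi (2 * Real.exp t)} = 1 / (2 * Real.exp t) :=
    pareto_real_lt hXm hX (by linarith)
  simp only [← measureReal_def]
  split_ifs with hz
  · have hnum : ({ω | YL ω - XL ω ≤ z} ∩ {ω | t < XL ω} : Set Ω) =ᵐ[μ] {ω | t < XL ω} := by
      filter_upwards [hae] with ω h1
      apply propext
      refine and_iff_right_of_imp fun h => ?_
      rcases hBvals ω with hB | hB
      · exact hdiff0 ω h1 h hB
      · exact (hdiff1 ω h1 h hB).le.trans hz
    rw [measureReal_congr hnum, measureReal_congr hden, hdenval, div_self (by positivity)]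
  · have hnum : ({ω | YL ω - XL ω ≤ z} ∩ {ω | t < XL ω} : Set Ω) =ᵐ[μ]
        ({ω | B ω = 0} ∩ {ω | X ω ∈ Ioi (2 * Real.exp t)} : Set Ω) := by
      filter_upwards [hae] with ω h1
      apply propext
      change YL ω - XL ω ≤ z ∧ t < XL ω ↔ B ω = 0 ∧ 2 * Real.exp t < X ω
      rw [← hXLgt t ht ω h1]
      refine and_congr_left fun h => ?_
      rcases hBvals ω with hB | hB
      · exact iff_of_true (hdiff0 ω h1 h hB) hB
      · rw [hdiff1 ω h1 h hB, hB]
        simpa using hz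
    rw [measureReal_congr hnum, measureReal_congr hden,
      measureReal_inter_of_indepFun hindep 0 measurableSet_Ioi, hdenval, hB0r]
    field_simp
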